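/- arXiv:1103.3732 — 2 statements merged into one kernel-verified Lean document; each statement's English description precedes it below -/
import Mathlib

section
/- Every proper circular-arc (PCA) model with at most one universal arc is twin-consecutive; that is, in such a model, every maximal family of pairwise twin arcs has all of its beginning points consecutive among the endpoints of the model and all of its ending points consecutive among the endpoints of the model. -/
open Set

noncomputable section

instance : Fact ((0:ℝ) < 1) := ⟨one_pos⟩

/-- A point on the circle (of circumference 1). -/
abbrev Circ : Type := AddCircle (1 : ℝ)

/-- An arc of the circle, described by its beginning point `s` and its ending point `t`
(the arc is traversed clockwise, i.e. in the positive circular direction, from `s` to `t`). -/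
structure Arc where
  s : Circ
  t : Circ

/-- The set of points of the open arc: the points strictly between `s` and `t`
in the circular order. -/
def Arc.pts (A : Arc) : Set Circ := {x | sbtw A.s x A.t}

/-- The length of an arc: the representative in `(0, 1]` of `t - s`. -/
def Arc.length (A : Arc) : ℝ := ((AddCircle.equivIoc (1:ℝ) 0) (A.t - A.s) : ℝ)

/-- A circular-arc (CA) model: a finite family of arcs of the circle such that all
endpoints of the arcs are pairwise distinct (in particular each arc has two distinct
endpoints, hence no arc covers the whole circle). -/
structure CAModel (V : Type) [Fintype V] where
  arc : V → Arc
  endpoints_distinct : Function.Injective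
    (fun p : V × Bool => if p.2 then (arc p.1).s else (arc p.1).t)

namespace CAModel

variable {V : Type} [Fintype V]

/-- The arcs of `u` and `v` intersect. -/
def Inter (M : CAModel V) (u v : V) : Prop := ((M.arc u).pts ∩ (M.arc v).pts).Nonempty

/-- The intersection graph of the model: two distinct arcs are adjacent iff they have
nonempty intersection. -/
def interGraph (M : CAModel V) : SimpleGraph V :=
  SimpleGraph.fromRel fun u v => M.Inter u v

/-- `M` is a model of the graph `G`: the arcs are in correspondence with the vertices of `G`
and two vertices are adjacent iff their arcs are distinct and intersect. -/
def IsModelOf (M : CAModel V) (G : SimpleGraph V) : Prop :=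
  ∀ u v, G.Adj u v ↔ u ≠ v ∧ M.Inter u v

/-- Helly model: every subfamily of pairwise intersecting arcs has a common point. -/
def Helly (M : CAModel V) : Prop :=
  ∀ S : Set V, (∀ u ∈ S, ∀ v ∈ S, M.Inter u v) → ∃ p : Circ, ∀ v ∈ S, p ∈ (M.arc v).pts

/-- Normal model: no two arcs together cover the whole circle. -/
def Normal (M : CAModel V) : Prop :=
  ∀ u v : V, u ≠ v → (M.arc u).pts ∪ (M.arc v).pts ≠ Set.univ

/-- No three arcs together cover the whole circle. -/
def NoThreeCover (M : CAModel V) : Prop :=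
  ∀ u v w : V, u ≠ v → u ≠ w → v ≠ w →
    (M.arc u).pts ∪ (M.arc v).pts ∪ (M.arc w).pts ≠ Set.univ

/-- Proper model: no arc is properly contained in another arc. -/
def Proper (M : CAModel V) : Prop :=
  ∀ u v : V, u ≠ v → ¬ (M.arc u).pts ⊂ (M.arc v).pts

/-- Unit model: all arcs have the same length. -/
def IsUnit (M : CAModel V) : Prop :=
  ∀ u v : V, (M.arc u).length = (M.arc v).length

/-- Interval model: some point of the circle is covered by no arc. -/
def IsIntervalModel (M : CAModel V) : Prop :=
  ∃ p : Circ, ∀ v : V, p ∉ (M.arc v).pts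

/-- A universal arc: it intersects every other arc of the model. -/
def UniversalArc (M : CAModel V) (v : V) : Prop :=
  ∀ w, w ≠ v → M.Inter v w

end CAModel

section GraphClasses

variable {V : Type} [Fintype V]

def IsCAGraph (G : SimpleGraph V) : Prop := ∃ M : CAModel V, M.IsModelOf G
def IsHCAGraph (G : SimpleGraph V) : Prop := ∃ M : CAModel V, M.Helly ∧ M.IsModelOf G
def IsNCAGraph (G : SimpleGraph V) : Prop := ∃ M : CAModel V, M.Normal ∧ M.IsModelOf G
def IsNHCAGraph (G : SimpleGraph V) : Prop :=
  ∃ M : CAModel V, M.Normal ∧ M.Helly ∧ M.IsModelOf G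
def IsPCAGraph (G : SimpleGraph V) : Prop := ∃ M : CAModel V, M.Proper ∧ M.IsModelOf G
def IsNPCAGraph (G : SimpleGraph V) : Prop :=
  ∃ M : CAModel V, M.Normal ∧ M.Proper ∧ M.IsModelOf G
def IsPHCAGraph (G : SimpleGraph V) : Prop :=
  ∃ M : CAModel V, M.Proper ∧ M.Helly ∧ M.IsModelOf G
def IsUCAGraph (G : SimpleGraph V) : Prop := ∃ M : CAModel V, M.IsUnit ∧ M.IsModelOf G
def IsUHCAGraph (G : SimpleGraph V) : Prop :=
  ∃ M : CAModel V, M.IsUnit ∧ M.Helly ∧ M.IsModelOf G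
def IsIntervalGraph (G : SimpleGraph V) : Prop :=
  ∃ M : CAModel V, M.IsIntervalModel ∧ M.IsModelOf G

end GraphClasses
namespace CAModel

variable {V : Type} [Fintype V]

/-- Two arcs are twins: they intersect each other and their vertices have the same
closed neighborhood in the intersection graph. -/
def Twins (M : CAModel V) (u v : V) : Prop :=
  M.Inter u v ∧ ∀ w : V, (w = u ∨ M.Inter u w) ↔ (w = v ∨ M.Inter v w)

/-- The set of all endpoints of the arcs of the model. -/
def endpointSet (M : CAModel V) : Set Circ :=
  (Set.range fun v => (M.arc v).s) ∪ Set.range fun v => (M.arc v).t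

end CAModel

/-- `P` is consecutive within `E` (circularly): there is a closed arc of the circle whose
intersection with `E` is exactly `P`. -/
def ConsecutiveIn (P E : Set Circ) : Prop :=
  ∃ a b : Circ, P = {e ∈ E | e = a ∨ e = b ∨ sbtw a e b}

/-- A model is twin-consecutive if, for every maximal family `F` of pairwise twin arcs,
the beginning points of the arcs of `F` appear consecutively in the circular order of all
endpoints of the model, and likewise the ending points of the arcs of `F`. -/
def CAModel.TwinConsecutive {V : Type} [Fintype V] (M : CAModel V) : Prop :=
  ∀ F : Set V, F.Nonempty →
    (∀ u ∈ F, ∀ v ∈ F, M.Twins u v) →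
    (∀ w : V, w ∉ F → ∃ u ∈ F, ¬ M.Twins u w) →
    ConsecutiveIn ((fun v => (M.arc v).s) '' F) M.endpointSet ∧
    ConsecutiveIn ((fun v => (M.arc v).t) '' F) M.endpointSet

/-- Strict circular betweenness for reals of one period. -/
def SB (a b c : ℝ) : Prop := (a < b ∧ b < c) ∨ (b < c ∧ c < a) ∨ (c < a ∧ a < b)

/-- Coordinate of a point in `[a, a+1)`. -/
def crd (a : ℝ) (x : Circ) : ℝ := (AddCircle.equivIco (1:ℝ) a x : ℝ)

lemma crd_mem (a : ℝ) (x : Circ) : a ≤ crd a x ∧ crd a x < a + 1 :=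
  (AddCircle.equivIco (1:ℝ) a x).2

lemma crd_coe (a : ℝ) (x : Circ) : ((crd a x : ℝ) : Circ) = x :=
  (AddCircle.equivIco (1:ℝ) a).symm_apply_apply x

lemma crd_of_mem (a r : ℝ) (h : a ≤ r ∧ r < a + 1) : crd a (r : Circ) = r := by
  have := (AddCircle.equivIco (1:ℝ) a).apply_symm_apply ⟨r, h⟩
  exact congrArg Subtype.val this

lemma crd_inj (a : ℝ) : Function.Injective (crd a) := fun x y h => by
  rw [← crd_coe a x, ← crd_coe a y, h]

lemma sbtw_real (a x y z : ℝ) (hx : a ≤ x ∧ x < a + 1) (hy : a ≤ y ∧ y < a + 1)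
    (hz : a ≤ z ∧ z < a + 1) : sbtw (x : Circ) (y : Circ) (z : Circ) ↔ SB x y z := by
  rw [sbtw_iff_not_btw]
  have h1 : toIcoMod (one_pos : (0:ℝ) < 1) z y = if z ≤ y then y else y + 1 := by
    split_ifs with h
    · exact (toIcoMod_eq_self _).2 ⟨h, by linarith⟩
    · rw [← toIcoMod_add_right]
      exact (toIcoMod_eq_self _).2 ⟨by linarith, by linarith⟩
  have h2 : toIocMod (one_pos : (0:ℝ) < 1) z x = if z < x then x else x + 1 := by
    split_ifs with h
    · exact (toIocMod_eq_self _).2 ⟨h, by linarith⟩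
    · rw [← toIocMod_add_right]
      exact (toIocMod_eq_self _).2 ⟨by linarith, by linarith⟩
  have h3 : btw (z : Circ) (y : Circ) (x : Circ) ↔
      toIcoMod (one_pos : (0:ℝ) < 1) z y ≤ toIocMod (one_pos : (0:ℝ) < 1) z x :=
    QuotientAddGroup.btw_coe_iff
  rw [h3, h1, h2]
  unfold SB
  split_ifs <;> grind

lemma sbtw_crd (a : ℝ) (x y z : Circ) : sbtw x y z ↔ SB (crd a x) (crd a y) (crd a z) := by
  rw [← sbtw_real a _ _ _ (crd_mem a x) (crd_mem a y) (crd_mem a z)]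
  simp only [crd_coe]

section Core
variable {V : Type} [Fintype V] (M : CAModel V)

def sg (a : ℝ) (v : V) : ℝ := crd a (M.arc v).s
def tu (a : ℝ) (v : V) : ℝ := crd a (M.arc v).t

lemma sg_ne (a : ℝ) {u v : V} (h : u ≠ v) : sg M a u ≠ sg M a v := fun e => by
  have := @M.endpoints_distinct (u, true) (v, true) (by simpa using crd_inj a e)
  simp at this; exact h this

lemma tu_ne (a : ℝ) {u v : V} (h : u ≠ v) : tu M a u ≠ tu M a v := fun e => by
  have := @M.endpoints_distinct (u, false) (v, false) (by simpa using crd_inj a e)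
  simp at this; exact h this

lemma sg_tu_ne (a : ℝ) (u v : V) : sg M a u ≠ tu M a v := fun e => by
  have := @M.endpoints_distinct (u, true) (v, false) (by simpa using crd_inj a e)
  simp at this

lemma mem_pts (a : ℝ) (v : V) (x : Circ) :
    x ∈ (M.arc v).pts ↔ SB (sg M a v) (crd a x) (tu M a v) := sbtw_crd a _ _ _

lemma inter_exists (a : ℝ) (u v : V) : M.Inter u v ↔ ∃ z : ℝ, (a ≤ z ∧ z < a + 1) ∧
    SB (sg M a u) z (tu M a u) ∧ SB (sg M a v) z (tu M a v) := by
  constructor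
  · rintro ⟨x, hx, hy⟩
    exact ⟨crd a x, crd_mem a x, (mem_pts M a _ _).1 hx, (mem_pts M a _ _).1 hy⟩
  · rintro ⟨z, hz, h1, h2⟩
    refine ⟨(z : Circ), (mem_pts M a _ _).2 ?_, (mem_pts M a _ _).2 ?_⟩ <;>
    rwa [crd_of_mem a z hz]

/-- a point just after `s` inside two arcs. -/
lemma just_after (a s t t' : ℝ) (hs : a ≤ s ∧ s < a + 1) (ht : a ≤ t ∧ t < a + 1)
    (ht' : a ≤ t' ∧ t' < a + 1) (h : s ≠ t) (h' : s ≠ t') :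
    ∃ z, s < z ∧ z < a + 1 ∧ SB s z t ∧ SB s z t' ∧ (s < t → z < t) := by
  have key : ∃ m, s < m ∧ m ≤ a + 1 ∧ (s < t → m ≤ t) ∧ (s < t' → m ≤ t') := by
    by_cases h1 : s < t <;> by_cases h2 : s < t'
    · exact ⟨min t t', by simp [*], by simp; left; linarith, by simp, by simp⟩
    · exact ⟨t, h1, by linarith, by simp, by simp [h2]⟩
    · exact ⟨t', h2, by linarith, by simp [h1], by simp⟩
    · exact ⟨a + 1, by linarith, by linarith, by simp [h1], by simp [h2]⟩
  obtain ⟨m, m1, m2, m3, m4⟩ := key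
  obtain ⟨z, z1, z2⟩ := exists_between m1
  refine ⟨z, z1, by linarith, ?_, ?_, fun q => by have := m3 q; linarith⟩ <;> unfold SB <;> grind

lemma inter_self (a : ℝ) (u : V) : M.Inter u u := by
  rw [inter_exists M a]
  obtain ⟨z, h1, h2, h3, h4, h5⟩ := just_after a (sg M a u) (tu M a u) (tu M a u)
    (crd_mem _ _) (crd_mem _ _) (crd_mem _ _) (sg_tu_ne M a u u) (sg_tu_ne M a u u)
  exact ⟨z, ⟨by have := (crd_mem a (M.arc u).s).1; unfold sg at h1; linarith, h2⟩, h3, h3⟩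

lemma inter_symm {u v : V} (h : M.Inter u v) : M.Inter v u := by
  obtain ⟨x, h1, h2⟩ := h
  exact ⟨x, h2, h1⟩

lemma inter_of (a : ℝ) (u v : V) (h : SB (sg M a u) (sg M a v) (tu M a u)) : M.Inter u v := by
  rw [inter_exists M a]
  have hv := crd_mem a (M.arc v).s
  obtain ⟨z, h1, h2, h3, h4, h5⟩ := just_after a (sg M a v) (tu M a u) (tu M a v)
    (crd_mem _ _) (crd_mem _ _) (crd_mem _ _) (sg_tu_ne M a v u) (sg_tu_ne M a v v)
  refine ⟨z, ⟨by unfold sg at h1; linarith, h2⟩, ?_, h4⟩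
  unfold SB at *
  grind

lemma inter_iff (a : ℝ) {u v : V} (h : u ≠ v) : M.Inter u v ↔
    SB (sg M a u) (sg M a v) (tu M a u) ∨ SB (sg M a v) (sg M a u) (tu M a v) := by
  constructor
  · rw [inter_exists M a]
    rintro ⟨z, -, h1, h2⟩
    have := sg_ne M a h
    unfold SB at *
    grind
  · rintro (h | h)
    · exact inter_of M a _ _ h
    · exact inter_symm M (inter_of M a _ _ h)

lemma proper_iff (hP : M.Proper) (a : ℝ) {u v : V} (h : u ≠ v)
    (h1 : SB (sg M a v) (sg M a u) (tu M a v)) (h2 : SB (sg M a v) (tu M a u) (tu M a v))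
    (h3 : SB (sg M a v) (sg M a u) (tu M a u)) : False := by
  apply hP u v h
  rw [Set.ssubset_iff_exists]
  refine ⟨fun x hx => ?_, (M.arc u).s, (mem_pts M a _ _).2 h1, fun hx => ?_⟩
  · rw [mem_pts M a] at *
    unfold SB at *
    grind
  · rw [mem_pts M a] at hx
    change SB (sg M a u) (sg M a u) (tu M a u) at hx
    unfold SB at hx
    grind

lemma twins_iff (a : ℝ) (u v : V) : M.Twins u v ↔ ∀ w, M.Inter u w ↔ M.Inter v w := by
  have hs := inter_self M a
  constructor
  · rintro ⟨h1, h2⟩ w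
    have := h2 w
    have := inter_symm M h1
    grind
  · intro h
    refine ⟨(h v).2 (hs v), fun w => ?_⟩
    have := h w
    have := hs w
    grind

/-- The combinatorial core: coordinates with the cut inside/at the arc `w` missed by `F`. -/
lemma core (I : V → V → Prop) (σ τ : V → ℝ) (w : V) (F : Set V) (hF : F.Nonempty)
    (hs : ∀ u v, u ≠ v → σ u ≠ σ v) (ht : ∀ u v, u ≠ v → τ u ≠ τ v)
    (hst : ∀ u v, σ u ≠ τ v)
    (hself : ∀ u, I u u) (hsymm : ∀ u v, I u v → I v u)
    (hI : ∀ u v, u ≠ v → (I u v ↔ SB (σ u) (σ v) (τ u) ∨ SB (σ v) (σ u) (τ v)))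
    (hPr : ∀ u v, u ≠ v → SB (σ v) (σ u) (τ v) → SB (σ v) (τ u) (τ v) →
      SB (σ v) (σ u) (τ u) → False)
    (hw1 : ∀ u, u ≠ w → σ w < σ u) (hw2 : ∀ u, σ w < τ u)
    (hwF : ∀ u ∈ F, ¬ I u w)
    (htw : ∀ u ∈ F, ∀ v ∈ F, ∀ x, I u x ↔ I v x)
    (hmax : ∀ x, (∀ u ∈ F, ∀ y, I u y ↔ I x y) → x ∈ F) :
    ∃ u ∈ F, ∃ v ∈ F, ∀ x,
      (x ∈ F ↔ (σ x = σ u ∨ σ x = σ v ∨ SB (σ u) (σ x) (σ v))) ∧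
      (x ∈ F ↔ (τ x = τ u ∨ τ x = τ v ∨ SB (τ u) (τ x) (τ v))) ∧
      ¬ SB (σ u) (τ x) (σ v) ∧ ¬ SB (τ u) (σ x) (τ v) := by
  have hwne : ∀ u ∈ F, u ≠ w := fun u hu e => hwF u hu (e ▸ hself u)
  have hpl : ∀ u ∈ F, τ w < σ u ∧ σ u < τ u := by
    intro u hu
    have h1 := hwF u hu
    rw [hI u w (hwne u hu)] at h1
    have := hw1 u (hwne u hu)
    have := hw2 u
    have := hw2 w
    have := hst u w
    have := hst u u
    unfold SB at h1
    grind
  obtain ⟨u, hu, humin⟩ := Set.exists_min_image F σ (Set.toFinite F) hF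
  obtain ⟨v, hv, hvmax⟩ := Set.exists_max_image F σ (Set.toFinite F) hF
  -- monotonicity for plain arcs
  have hplain : ∀ x y, σ x < τ x → σ y < τ y → σ x < σ y → τ x < τ y := by
    intro x y hx hy hxy
    by_contra hc
    have hne : y ≠ x := by rintro rfl; exact lt_irrefl _ hxy
    have h1 := ht y x hne
    have h2 : τ y < τ x := lt_of_le_of_ne (not_lt.1 hc) h1
    exact hPr y x hne (Or.inl ⟨hxy, by linarith⟩) (Or.inl ⟨by linarith, h2⟩) (Or.inl ⟨hxy, hy⟩)
  -- wrapping arcs end before the end of w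
  have hwrap : ∀ x, x ≠ w → τ x < σ x → τ x < τ w := by
    intro x hx hxx
    by_contra hc
    have h1 := ht x w hx
    have h2 : τ w < τ x := lt_of_le_of_ne (not_lt.1 hc) (Ne.symm h1)
    have := hw1 x hx
    have := hw2 w
    have := hw2 x
    refine hPr w x (Ne.symm hx) ?_ ?_ ?_ <;> unfold SB <;> grind
  have hpu := hpl u hu
  have hpv := hpl v hv
  have hple : ∀ x y, σ x < τ x → σ y < τ y → σ x ≤ σ y → τ x ≤ τ y := by
    intro x y h1 h2 h3
    by_cases e : x = y
    · rw [e]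
    · exact (hplain x y h1 h2 (lt_of_le_of_ne h3 (hs x y e))).le
  have hsuv := humin v hv
  have htuv := hple u v hpu.2 hpv.2 hsuv
  have huv : σ v < τ u := by
    by_cases e : u = v
    · rw [← e]; exact hpu.2
    · have h1 : I u v := (htw v hv u hu v).1 (hself v)
      rw [hI u v e] at h1
      unfold SB at h1
      grind
  have plain_not : ∀ x y, σ x < τ x → σ y < τ y → τ x < σ y → ¬ I x y := by
    intro x y h1 h2 h3 h4
    have e : x ≠ y := by rintro rfl; linarith
    rw [hI x y e] at h4
    unfold SB at h4
    grind
  -- an arc strictly between u and v is a twin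
  have hin : ∀ x, σ u < σ x → σ x < σ v → τ u < τ x → τ x < τ v → x ∈ F := by
    intro x h1 h2 h3 h4
    have hxu : x ≠ u := by rintro rfl; exact lt_irrefl _ h1
    have hxv : x ≠ v := by rintro rfl; exact lt_irrefl _ h2
    have huvne : u ≠ v := by rintro rfl; linarith
    have key : ∀ y, I u y ↔ I x y := by
      intro y
      have huvy := htw u hu v hv y
      by_cases hyx : y = x
      · subst hyx
        have : I u y := (hI u y (Ne.symm hxu)).2 (Or.inl (Or.inl ⟨h1, by linarith⟩))
        simp [this, hself]
      by_cases hyu : y = u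
      · subst hyu
        have : I x y := (hI x y hxu).2 (Or.inr (Or.inl ⟨h1, by linarith⟩))
        simp [this, hself]
      by_cases hyv : y = v
      · subst hyv
        have a1 : I x y := (hI x y hxv).2 (Or.inl (Or.inl ⟨h2, by linarith⟩))
        have a2 : I u y := huvy.2 (hself y)
        simp [a1, a2]
      by_cases hyw : y = w
      · subst hyw
        have a1 := hwF u hu
        have a2 : ¬ I x y := by
          rw [hI x y (Ne.symm hyx)]
          have := hw2 y
          have := hw1 u (hwne u hu)
          unfold SB
          grind
        simp [a1, a2]
      have b1 := hs y x hyx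
      have b2 := hs y u hyu
      have b3 := hs y v hyv
      have c1 := hst x y
      have c2 := hst u y
      have c3 := hst v y
      have d1 := hst y x
      have d2 := hst y u
      have d3 := hst y v
      have d4 := hst y y
      have w1 := hwrap y hyw
      rw [hI u y (Ne.symm hyu), hI v y (Ne.symm hyv)] at huvy
      rw [hI u y (Ne.symm hyu), hI x y (Ne.symm hyx)]
      unfold SB at *
      rcases lt_or_gt_of_ne d4 with d | d
      · grind
      · have := w1 d
        grind
    exact hmax x fun z hz y => (htw z hz u hu y).trans (key y)
  -- x in F lies between
  have hmem : ∀ x ∈ F, (σ u ≤ σ x ∧ σ x ≤ σ v) ∧ (τ u ≤ τ x ∧ τ x ≤ τ v) := by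
    intro x hx
    have a1 := humin x hx
    have a2 := hvmax x hx
    exact ⟨⟨a1, a2⟩, hple u x hpu.2 (hpl x hx).2 a1, hple x v (hpl x hx).2 hpv.2 a2⟩
  have sinj : ∀ x y, σ x = σ y → x = y := fun x y h => by
    by_contra e; exact hs x y e h
  have tinj : ∀ x y, τ x = τ y → x = y := fun x y h => by
    by_contra e; exact ht x y e h
  have SBle : ∀ p q r : ℝ, p ≤ r → SB p q r → p < q ∧ q < r := by
    intro p q r h1 h2
    unfold SB at h2
    grind
  refine ⟨u, hu, v, hv, fun x => ⟨⟨fun hx => ?_, ?_⟩, ⟨fun hx => ?_, ?_⟩, ?_, ?_⟩⟩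
  · have := hmem x hx
    unfold SB
    grind
  · rintro (h | h | h)
    · rwa [sinj _ _ h]
    · rwa [sinj _ _ h]
    · obtain ⟨h1, h2⟩ := SBle _ _ _ hsuv h
      have hxw : x ≠ w := by rintro rfl; have := hw2 x; linarith [hw1 u (hwne u hu)]
      have hxv : x ≠ v := by rintro rfl; exact lt_irrefl _ h2
      have hpx : σ x < τ x := by
        by_contra hc
        have h3 : τ x < σ x := lt_of_le_of_ne (not_lt.1 hc) (Ne.symm (hst x x))
        have h4 := hwrap x hxw h3
        refine hPr v x hxv.symm ?_ ?_ ?_ <;> unfold SB <;> grind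
      exact hin x h1 h2 (hplain u x hpu.2 hpx h1) (hplain x v hpx hpv.2 h2)
  · have := hmem x hx
    unfold SB
    grind
  · rintro (h | h | h)
    · rwa [tinj _ _ h]
    · rwa [tinj _ _ h]
    · obtain ⟨h1, h2⟩ := SBle _ _ _ htuv h
      have hxw : x ≠ w := by rintro rfl; linarith
      have hpx : σ x < τ x := by
        by_contra hc
        have h3 : τ x < σ x := lt_of_le_of_ne (not_lt.1 hc) (Ne.symm (hst x x))
        linarith [hwrap x hxw h3]
      refine hin x ?_ ?_ h1 h2
      · by_contra hc
        linarith [hple x u hpx hpu.2 (not_lt.1 hc)]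
      · by_contra hc
        linarith [hple v x hpv.2 hpx (not_lt.1 hc)]
  · intro h
    obtain ⟨h1, h2⟩ := SBle _ _ _ hsuv h
    have hxw : x ≠ w := by rintro rfl; linarith
    have hpx : σ x < τ x := by
      by_contra hc
      have h3 : τ x < σ x := lt_of_le_of_ne (not_lt.1 hc) (Ne.symm (hst x x))
      linarith [hwrap x hxw h3]
    have hxu : x ≠ u := by rintro rfl; linarith
    have n1 := plain_not x v hpx hpv.2 h2
    have n2 : ¬ I u x := fun q => n1 (hsymm _ _ ((htw u hu v hv x).1 q))
    apply n2
    rw [hI u x hxu.symm]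
    have := hs x u hxu
    unfold SB
    grind
  · intro h
    obtain ⟨h1, h2⟩ := SBle _ _ _ htuv h
    have hxw : x ≠ w := by rintro rfl; linarith [hw1 u (hwne u hu)]
    have hxv : x ≠ v := by rintro rfl; linarith
    have hxu : x ≠ u := by rintro rfl; linarith
    have y1 : I v x := (hI v x hxv.symm).2 (Or.inl (Or.inl ⟨by linarith, h2⟩))
    have y2 : I u x := (htw v hv u hu x).1 y1
    rw [hI u x hxu.symm] at y2
    have := hwrap x hxw
    have := hst x x
    unfold SB at y2
    grind

end Core

/-- Every proper circular-arc model with at most one universal arc is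
twin-consecutive. -/
theorem stmt_14 {V : Type} [Fintype V] (M : CAModel V) (hP : M.Proper)
    (hU : ∀ u v : V, M.UniversalArc u → M.UniversalArc v → u = v) :
    M.TwinConsecutive := by
  intro F hF htw hmax
  by_cases hnt : F.Subsingleton
  · obtain ⟨u, hu⟩ := hF
    have hFu : F = {u} := hnt.eq_singleton_of_mem hu
    subst hFu
    have nos : ∀ p e : Circ, ¬ sbtw p e p := fun p e h => by
      rw [sbtw_crd 0] at h
      unfold SB at h
      grind
    refine ⟨⟨(M.arc u).s, (M.arc u).s, ?_⟩, ⟨(M.arc u).t, (M.arc u).t, ?_⟩⟩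
    · ext e
      simp only [Set.image_singleton, Set.mem_singleton_iff, Set.mem_ofPred_eq, nos, or_false,
        or_self]
      exact ⟨fun h => ⟨Or.inl ⟨u, h.symm⟩, h⟩, fun h => h.2⟩
    · ext e
      simp only [Set.image_singleton, Set.mem_singleton_iff, Set.mem_ofPred_eq, nos, or_false,
        or_self]
      exact ⟨fun h => ⟨Or.inr ⟨u, h.symm⟩, h⟩, fun h => h.2⟩
  rw [Set.not_subsingleton_iff] at hnt
  obtain ⟨u0, h0, u1, h1, h01⟩ := hnt
  have htw' : ∀ u ∈ F, ∀ v ∈ F, ∀ x, M.Inter u x ↔ M.Inter v x := fun u hu v hv =>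
    (twins_iff M 0 u v).1 (htw u hu v hv)
  have hw : ∃ w, ¬ M.Inter u0 w := by
    by_contra! hc
    exact h01 (hU u0 u1 (fun w _ => hc w) (fun w _ => (htw' u0 h0 u1 h1 w).1 (hc w)))
  obtain ⟨w, hw⟩ := hw
  obtain ⟨a, ha⟩ := QuotientAddGroup.mk_surjective (M.arc w).s
  have hsw : sg M a w = a := by
    unfold sg
    rw [← ha]
    exact crd_of_mem a a ⟨le_rfl, by linarith⟩
  obtain ⟨u, hu, v, hv, H⟩ := core M.Inter (sg M a) (tu M a) w F ⟨u0, h0⟩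
    (fun u v => sg_ne M a) (fun u v => tu_ne M a) (sg_tu_ne M a) (inter_self M a)
    (fun u v => inter_symm M) (fun u v => inter_iff M a) (fun u v => proper_iff M hP a)
    (fun u hu => lt_of_le_of_ne (hsw.le.trans (crd_mem a _).1) (sg_ne M a hu.symm))
    (fun u => lt_of_le_of_ne (hsw.le.trans (crd_mem a _).1) (sg_tu_ne M a w u))
    (fun u hu q => hw ((htw' u hu u0 h0 w).1 q)) htw'
    (fun x hx => by
      by_contra hxF
      obtain ⟨u, hu, hn⟩ := hmax x hxF
      exact hn ((twins_iff M 0 u x).2 (hx u hu)))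
  have E : ∀ x y : Circ, x = y ↔ crd a x = crd a y := fun x y => (crd_inj a).eq_iff.symm
  refine ⟨⟨(M.arc u).s, (M.arc v).s, ?_⟩, ⟨(M.arc u).t, (M.arc v).t, ?_⟩⟩
  · ext e
    constructor
    · rintro ⟨x, hx, rfl⟩
      refine ⟨Or.inl ⟨x, rfl⟩, ?_⟩
      rw [sbtw_crd a, E, E]
      exact (H x).1.1 hx
    · rintro ⟨⟨x, rfl⟩ | ⟨x, rfl⟩, h⟩
      · rw [sbtw_crd a, E, E] at h
        exact ⟨x, (H x).1.2 h, rfl⟩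
      · rw [sbtw_crd a, E, E] at h
        rcases h with h | h | h
        · exact absurd h.symm (sg_tu_ne M a u x)
        · exact absurd h.symm (sg_tu_ne M a v x)
        · exact absurd h (H x).2.2.1
  · ext e
    constructor
    · rintro ⟨x, hx, rfl⟩
      refine ⟨Or.inr ⟨x, rfl⟩, ?_⟩
      rw [sbtw_crd a, E, E]
      exact (H x).2.1.1 hx
    · rintro ⟨⟨x, rfl⟩ | ⟨x, rfl⟩, h⟩
      · rw [sbtw_crd a, E, E] at h
        rcases h with h | h | h
        · exact absurd h (sg_tu_ne M a x u)
        · exact absurd h (sg_tu_ne M a x v)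
        · exact absurd h (H x).2.2.2
      · rw [sbtw_crd a, E, E] at h
        exact ⟨x, (H x).2.1.2 h, rfl⟩
end
end

section
/- A graph is a normal circular-arc (NCA) graph if and only if it admits an out-round orientation. -/
open Set

noncomputable section

/-! ### GraphOrientations and round / straight enumerations -/

/-- An orientation of a graph `G`: each edge of `G` receives exactly one direction. -/
structure GraphOrientation {V : Type} (G : SimpleGraph V) where
  dir : V → V → Prop
  dir_adj : ∀ u v, dir u v → G.Adj u v
  adj_dir : ∀ u v, G.Adj u v → (dir u v ↔ ¬ dir v u)

namespace GraphOrientation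

variable {V : Type} [Fintype V] {G : SimpleGraph V}

/-- The out-degree `d⁺(v)` of a vertex. -/
def outDeg (D : GraphOrientation G) (v : V) : ℕ := {w | D.dir v w}.ncard

/-- The in-degree `d⁻(v)` of a vertex. -/
def inDeg (D : GraphOrientation G) (v : V) : ℕ := {w | D.dir w v}.ncard

end GraphOrientation

/-- The clockwise (forward) circular distance from position `i` to position `j`
among `n` circular positions. -/
def cdist (n : ℕ) (i j : Fin n) : ℕ := ((j : ℕ) + n - (i : ℕ)) % n

variable {V : Type} [Fintype V] {G : SimpleGraph V}

/-- `σ` is an out-round enumeration of `D`: for every `i`,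
`N⁺[v_i] = {v_i, v_{i+1}, …, v_{i+d⁺(v_i)}}`, indices modulo `n`; equivalently,
`v_j ∈ N⁺[v_i]` iff the clockwise distance from `i` to `j` is at most `d⁺(v_i)`. -/
def IsOutRoundEnum (D : GraphOrientation G) (σ : Fin (Fintype.card V) ≃ V) : Prop :=
  ∀ i j : Fin (Fintype.card V),
    (σ j = σ i ∨ D.dir (σ i) (σ j)) ↔
      cdist (Fintype.card V) i j ≤ D.outDeg (σ i)

/-- `σ` is a round enumeration of `D`: additionally to the out-round condition,
`N⁻[v_i] = {v_{i-d⁻(v_i)}, …, v_i}`, indices modulo `n`. -/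
def IsRoundEnum (D : GraphOrientation G) (σ : Fin (Fintype.card V) ≃ V) : Prop :=
  ∀ i j : Fin (Fintype.card V),
    ((σ j = σ i ∨ D.dir (σ i) (σ j)) ↔
      cdist (Fintype.card V) i j ≤ D.outDeg (σ i)) ∧
    ((σ j = σ i ∨ D.dir (σ j) (σ i)) ↔
      cdist (Fintype.card V) j i ≤ D.inDeg (σ i))

/-- Position `l` holds the leftmost neighbor of `v_i`: `v_l ∈ N⁻[v_i]` and `v_l` is the
member of `N⁻[v_i]` reached last when traversing the enumeration backwards from `v_i`. -/
def IsLeftmostPos (D : GraphOrientation G) (σ : Fin (Fintype.card V) ≃ V)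
    (i l : Fin (Fintype.card V)) : Prop :=
  (σ l = σ i ∨ D.dir (σ l) (σ i)) ∧
  ∀ l' : Fin (Fintype.card V), (σ l' = σ i ∨ D.dir (σ l') (σ i)) →
    cdist (Fintype.card V) l' i ≤ cdist (Fintype.card V) l i

/-- Position `r` holds the rightmost neighbor of `v_i`: `v_r ∈ N⁺[v_i]` and `v_r` is the
member of `N⁺[v_i]` reached last when traversing the enumeration forwards from `v_i`. -/
def IsRightmostPos (D : GraphOrientation G) (σ : Fin (Fintype.card V) ≃ V)
    (i r : Fin (Fintype.card V)) : Prop :=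
  (σ r = σ i ∨ D.dir (σ i) (σ r)) ∧
  ∀ r' : Fin (Fintype.card V), (σ r' = σ i ∨ D.dir (σ i) (σ r')) →
    cdist (Fintype.card V) i r' ≤ cdist (Fintype.card V) i r

/-- The out-degree of `v_j` inside the scope `Cir[v_l, v_r]` (the subdigraph induced by
the positions in the circular range from `l` to `r`). -/
def scopeOutDeg (D : GraphOrientation G) (σ : Fin (Fintype.card V) ≃ V)
    (l r j : Fin (Fintype.card V)) : ℕ :=
  {k : Fin (Fintype.card V) |
    cdist (Fintype.card V) l k ≤ cdist (Fintype.card V) l r ∧ D.dir (σ j) (σ k)}.ncard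

/-- The in-degree of `v_j` inside the scope `Cir[v_l, v_r]`. -/
def scopeInDeg (D : GraphOrientation G) (σ : Fin (Fintype.card V) ≃ V)
    (l r j : Fin (Fintype.card V)) : ℕ :=
  {k : Fin (Fintype.card V) |
    cdist (Fintype.card V) l k ≤ cdist (Fintype.card V) l r ∧ D.dir (σ k) (σ j)}.ncard

/-- `σ` is a locally out-straight enumeration: it is out-round and, for every vertex
`v_i`, its scope `Cir[v_l, v_r]` (where `v_l`, `v_r` are the leftmost and rightmost
neighbors of `v_i`), in the order induced by `σ` (position within the scope being the
clockwise distance from `l`), is an out-straight enumeration of the induced subdigraph: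
for `v_j, v_k` in the scope, `v_k ∈ N⁺[v_j]` (within the scope) iff the position of `v_k`
lies in the linear range from the position of `v_j` to the position of `v_j` plus the
out-degree of `v_j` in the subdigraph. -/
def IsLocallyOutStraightEnum (D : GraphOrientation G) (σ : Fin (Fintype.card V) ≃ V) : Prop :=
  IsOutRoundEnum D σ ∧
  ∀ i l r : Fin (Fintype.card V),
    IsLeftmostPos D σ i l → IsRightmostPos D σ i r →
    ∀ j k : Fin (Fintype.card V),
      cdist (Fintype.card V) l j ≤ cdist (Fintype.card V) l r →
      cdist (Fintype.card V) l k ≤ cdist (Fintype.card V) l r →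
      ((σ k = σ j ∨ D.dir (σ j) (σ k)) ↔
        (cdist (Fintype.card V) l j ≤ cdist (Fintype.card V) l k ∧
         cdist (Fintype.card V) l k ≤ cdist (Fintype.card V) l j + scopeOutDeg D σ l r j))

/-- `σ` is a locally straight enumeration: it is round and, for every vertex `v_i`, its
scope `Cir[v_l, v_r]`, in the order induced by `σ`, is a straight enumeration of the
induced subdigraph: for `v_j, v_k` in the scope, `v_k ∈ N⁺[v_j]` (within the scope) iff
the position of `v_k` lies in the linear range from `v_j` forwards of length the
out-degree of `v_j` in the subdigraph, and `v_k ∈ N⁻[v_j]` (within the scope) iff the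
position of `v_k` lies in the linear range ending at `v_j` of length the in-degree of
`v_j` in the subdigraph. -/
def IsLocallyStraightEnum (D : GraphOrientation G) (σ : Fin (Fintype.card V) ≃ V) : Prop :=
  IsRoundEnum D σ ∧
  ∀ i l r : Fin (Fintype.card V),
    IsLeftmostPos D σ i l → IsRightmostPos D σ i r →
    ∀ j k : Fin (Fintype.card V),
      cdist (Fintype.card V) l j ≤ cdist (Fintype.card V) l r →
      cdist (Fintype.card V) l k ≤ cdist (Fintype.card V) l r →
      (((σ k = σ j ∨ D.dir (σ j) (σ k)) ↔
        (cdist (Fintype.card V) l j ≤ cdist (Fintype.card V) l k ∧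
         cdist (Fintype.card V) l k ≤ cdist (Fintype.card V) l j + scopeOutDeg D σ l r j)) ∧
       ((σ k = σ j ∨ D.dir (σ k) (σ j)) ↔
        (cdist (Fintype.card V) l k ≤ cdist (Fintype.card V) l j ∧
         cdist (Fintype.card V) l j ≤ cdist (Fintype.card V) l k + scopeInDeg D σ l r j)))
/-- clockwise distance from `a` to `b` on the circle, in `[0,1)`. -/
def cd (a b : Circ) : ℝ := ((AddCircle.equivIco (1:ℝ) 0) (b - a) : ℝ)

lemma cd_nonneg (a b : Circ) : 0 ≤ cd a b := ((AddCircle.equivIco (1:ℝ) 0) (b - a)).2.1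

lemma cd_lt (a b : Circ) : cd a b < 1 := by
  have := ((AddCircle.equivIco (1:ℝ) 0) (b - a)).2.2
  simpa [cd] using this

lemma cd_coe (a b : Circ) : ((cd a b : ℝ) : Circ) = b - a :=
  (AddCircle.equivIco (1:ℝ) 0).symm_apply_apply (b - a)

lemma cd_unique (a b : Circ) (r : ℝ) (h0 : 0 ≤ r) (h1 : r < 1) (h : (r : Circ) = b - a) :
    cd a b = r := by
  unfold cd
  rw [← h, AddCircle.equivIco_coe_eq (p := (1:ℝ)) (a := 0) ⟨h0, by simpa using h1⟩]

lemma cd_self (a : Circ) : cd a a = 0 := cd_unique a a 0 le_rfl one_pos (by simp)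

lemma cd_eq_zero {a b : Circ} (h : cd a b = 0) : a = b := by
  have := cd_coe a b
  rw [h] at this
  have h2 : b - a = 0 := by rw [← this]; simp
  exact (sub_eq_zero.mp h2).symm

lemma cd_pos {a b : Circ} (h : a ≠ b) : 0 < cd a b :=
  lt_of_le_of_ne (cd_nonneg a b) (fun h' => h (cd_eq_zero h'.symm))

lemma coe_sub_one (r : ℝ) : ((r - 1 : ℝ) : Circ) = (r : Circ) := by
  rw [AddCircle.coe_sub, AddCircle.coe_period, sub_zero]

lemma cd_add (a b c : Circ) : cd a c = cd a b + cd b c ∨ cd a c = cd a b + cd b c - 1 := by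
  have h : ((cd a b + cd b c : ℝ) : Circ) = c - a := by
    rw [AddCircle.coe_add, cd_coe, cd_coe]; abel
  have h1 := cd_nonneg a b
  have h2 := cd_nonneg b c
  have h3 := cd_lt a b
  have h4 := cd_lt b c
  by_cases hl : cd a b + cd b c < 1
  · left; exact cd_unique _ _ _ (by linarith) hl h
  · right; exact cd_unique _ _ _ (by linarith) (by linarith) (by rw [coe_sub_one]; exact h)


lemma sbtw_iff_cd (s x t : Circ) : sbtw s x t ↔ 0 < cd s x ∧ cd s x < cd s t := by
  rw [sbtw_iff_not_btw, btw_cyclic]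
  induction s using QuotientAddGroup.induction_on with | _ s
  induction x using QuotientAddGroup.induction_on with | _ x
  induction t using QuotientAddGroup.induction_on with | _ t
  rw [QuotientAddGroup.btw_coe_iff', not_le]
  have ht : cd (s : Circ) (t : Circ) = toIcoMod (one_pos : (0:ℝ) < 1) 0 (t - s) := rfl
  have hx : cd (s : Circ) (x : Circ) = toIcoMod (one_pos : (0:ℝ) < 1) 0 (x - s) := rfl
  have h1 := toIocMod_mem_Ioc (one_pos : (0:ℝ) < 1) 0 (x - s)
  have hc : ((toIocMod (one_pos : (0:ℝ) < 1) 0 (x - s) : ℝ) : Circ) = (x : Circ) - (s : Circ) := by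
    rw [← AddCircle.coe_sub]
    exact (AddCircle.equivIoc (1:ℝ) 0).symm_apply_apply ((x - s : ℝ) : Circ)
  have h4 := cd_lt (s : Circ) (t : Circ)
  have h5 := cd_nonneg (s : Circ) (x : Circ)
  change toIocMod (one_pos : (0:ℝ) < 1) 0 (x - s) < toIcoMod (one_pos : (0:ℝ) < 1) 0 (t - s) ↔
    0 < cd (s : Circ) (x : Circ) ∧ cd (s : Circ) (x : Circ) < cd (s : Circ) (t : Circ)
  rw [← ht]
  set y := toIocMod (one_pos : (0:ℝ) < 1) 0 (x - s) with hy
  rcases lt_or_ge y 1 with hlt | hge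
  · rw [cd_unique _ _ y h1.1.le hlt hc]
    exact ⟨fun h => ⟨h1.1, h⟩, fun h => h.2⟩
  · have h2 : y = 1 := le_antisymm (by simpa using h1.2) hge
    have : cd (s : Circ) (x : Circ) = 0 := by
      apply cd_unique _ _ 0 le_rfl one_pos
      rw [← hc, h2, AddCircle.coe_period]; simp
    rw [this, h2]
    constructor
    · intro h; linarith
    · intro h; exact absurd h.1 (lt_irrefl _)

lemma cd_shift (a : Circ) (r : ℝ) (h0 : 0 ≤ r) (h1 : r < 1) : cd a (a + (r : Circ)) = r :=
  cd_unique _ _ _ h0 h1 (by abel)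

lemma cd_swap {a b : Circ} (h : a ≠ b) : cd a b + cd b a = 1 := by
  have h1 := cd_pos h
  have h2 := cd_pos h.symm
  have h3 := cd_self a
  rcases cd_add a b a with h4 | h4 <;> linarith

/-- start of `B` lies in `A`. -/
def StartIn (A B : Arc) : Prop := 0 < cd A.s B.s ∧ cd A.s B.s < cd A.s A.t

lemma startIn_inter (A B : Arc) (hB : B.s ≠ B.t) (h : StartIn A B) :
    (A.pts ∩ B.pts).Nonempty := by
  obtain ⟨h1, h2⟩ := h
  have h3 := cd_pos hB
  have h4 := cd_lt B.s B.t
  have h5 := cd_lt A.s A.t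
  obtain ⟨e, he0, he1, he2⟩ : ∃ e, 0 < e ∧ e < cd B.s B.t ∧ e < cd A.s A.t - cd A.s B.s := by
    obtain ⟨e, h, h'⟩ := exists_between (lt_min h3 (sub_pos.mpr h2))
    exact ⟨e, h, lt_of_lt_of_le h' (min_le_left _ _), lt_of_lt_of_le h' (min_le_right _ _)⟩
  have h6 := cd_shift B.s e he0.le (by linarith)
  have h7 := cd_nonneg A.s (B.s + (e : Circ))
  refine ⟨B.s + (e : Circ), (sbtw_iff_cd _ _ _).2 ?_, (sbtw_iff_cd _ _ _).2 ?_⟩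
  · rcases cd_add A.s B.s (B.s + (e : Circ)) with h8 | h8 <;> constructor <;> linarith
  · rw [h6]; exact ⟨he0, he1⟩

lemma inter_iff_s17 (A B : Arc) (h : A.s ≠ B.s) (hA : A.s ≠ A.t) (hB : B.s ≠ B.t) :
    (A.pts ∩ B.pts).Nonempty ↔ (StartIn A B ∨ StartIn B A) := by
  constructor
  · rintro ⟨x, hxA, hxB⟩
    have a1 := (sbtw_iff_cd _ _ _).1 hxA
    have b1 := (sbtw_iff_cd _ _ _).1 hxB
    have h1 := cd_swap h
    have h2 := cd_pos h
    have h3 := cd_pos h.symm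
    rcases cd_add A.s B.s x with h8 | h8
    · left; exact ⟨h2, by linarith⟩
    · right; exact ⟨h3, by linarith⟩
  · rintro (h | h)
    · exact startIn_inter A B hB h
    · rw [Set.inter_comm]; exact startIn_inter B A hA h

lemma cover_iff (A B : Arc) (h : A.s ≠ B.s) :
    A.pts ∪ B.pts = Set.univ ↔ (StartIn A B ∧ StartIn B A) := by
  constructor
  · intro hu
    constructor
    · have : B.s ∈ A.pts ∪ B.pts := hu ▸ Set.mem_univ _
      rcases this with h | h
      · exact (sbtw_iff_cd _ _ _).1 h
      · have := ((sbtw_iff_cd _ _ _).1 h).1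
        rw [cd_self] at this
        exact absurd this (lt_irrefl _)
    · have : A.s ∈ A.pts ∪ B.pts := hu ▸ Set.mem_univ _
      rcases this with h | h
      · have := ((sbtw_iff_cd _ _ _).1 h).1
        rw [cd_self] at this
        exact absurd this (lt_irrefl _)
      · exact (sbtw_iff_cd _ _ _).1 h
  · rintro ⟨⟨h1, h2⟩, h3, h4⟩
    have h5 := cd_swap h
    rw [Set.eq_univ_iff_forall]
    intro x
    have h6 := cd_lt A.s x
    have h7 := cd_lt B.s x
    by_cases hx : A.s = x
    · right; subst hx; exact (sbtw_iff_cd _ _ _).2 ⟨h3, h4⟩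
    have h8 := cd_pos hx
    by_cases hx2 : cd A.s x < cd A.s A.t
    · left; exact (sbtw_iff_cd _ _ _).2 ⟨h8, hx2⟩
    · right
      apply (sbtw_iff_cd _ _ _).2
      rcases cd_add A.s B.s x with h9 | h9
      · constructor <;> linarith
      · exfalso; linarith

lemma cdist_cases (n : ℕ) (i j : Fin n) :
    (i ≤ j ∧ cdist n i j + i = j) ∨ (j < i ∧ cdist n i j + i = j + n) := by
  have hi := i.2
  have hj := j.2
  unfold cdist
  rcases le_or_gt i j with h | h
  · left
    refine ⟨h, ?_⟩
    have h' : (i : ℕ) ≤ j := h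
    have : (j : ℕ) + n - i = (j - i) + n := by omega
    rw [this, Nat.add_mod_right, Nat.mod_eq_of_lt (by omega)]
    omega
  · right
    refine ⟨h, ?_⟩
    have h' : (j : ℕ) < i := h
    rw [Nat.mod_eq_of_lt (by omega)]
    omega

lemma cdist_lt (n : ℕ) (i j : Fin n) : cdist n i j < n := by
  have hi := i.2
  have hj := j.2
  rcases cdist_cases n i j with ⟨h, h'⟩ | ⟨h, h'⟩
  · omega
  · have : (j : ℕ) < i := h
    omega

lemma cdist_inj (n : ℕ) (i j k : Fin n) (h : cdist n i j = cdist n i k) : j = k := by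
  have hk := k.2
  have hj := j.2
  apply Fin.ext
  rcases cdist_cases n i j with ⟨h1, h'⟩ | ⟨h1, h'⟩ <;>
  rcases cdist_cases n i k with ⟨h2, h''⟩ | ⟨h2, h''⟩ <;>
  simp only [Fin.le_def, Fin.lt_def] at h1 h2 <;> omega

lemma cdist_surj (n : ℕ) (i : Fin n) (m : ℕ) (hm : m < n) : ∃ k, cdist n i k = m := by
  have hi := i.2
  by_cases h : i + m < n
  · refine ⟨⟨i + m, h⟩, ?_⟩
    rcases cdist_cases n i ⟨i + m, h⟩ with ⟨h1, h'⟩ | ⟨h1, h'⟩ <;>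
      simp only [Fin.le_def, Fin.lt_def] at h1 h' <;> omega
  · refine ⟨⟨i + m - n, by omega⟩, ?_⟩
    rcases cdist_cases n i ⟨i + m - n, by omega⟩ with ⟨h1, h'⟩ | ⟨h1, h'⟩ <;>
      simp only [Fin.le_def, Fin.lt_def] at h1 h' <;> omega

lemma cdist_self (n : ℕ) (i : Fin n) : cdist n i i = 0 := by
  rcases cdist_cases n i i with ⟨h1, h'⟩ | ⟨h1, h'⟩
  · omega
  · exact absurd h1 (lt_irrefl _)

/-- A set of positions closed downwards for the clockwise distance is an initial range. -/
lemma initial_range (n : ℕ) (i : Fin n) (S : Set (Fin n)) (d : ℕ) (hd : S.ncard = d + 1)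
    (hS : ∀ j k, k ∈ S → cdist n i j < cdist n i k → j ∈ S) (j : Fin n) :
    j ∈ S ↔ cdist n i j ≤ d := by
  have hinj : Function.Injective (cdist n i) := fun a b h => cdist_inj n i a b h
  have hc : (cdist n i '' S).ncard = d + 1 := by
    rw [Set.ncard_image_of_injective _ hinj, hd]
  constructor
  · intro hj
    have hsub : (↑(Finset.range (cdist n i j + 1)) : Set ℕ) ⊆ cdist n i '' S := by
      intro m hm
      have hm' : m < cdist n i j + 1 := by simpa using hm
      rcases Nat.lt_or_ge m (cdist n i j) with hlt | hge
      · obtain ⟨k, hk⟩ := cdist_surj n i m (lt_trans hlt (cdist_lt n i j))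
        exact ⟨k, hS k j hj (by omega), hk⟩
      · exact ⟨j, hj, by omega⟩
    have := Set.ncard_le_ncard hsub (Set.toFinite _)
    rw [hc, Set.ncard_coe_finset, Finset.card_range] at this
    omega
  · intro hj
    by_contra hn
    have hsub : cdist n i '' S ⊆ (↑(Finset.range (cdist n i j)) : Set ℕ) := by
      rintro _ ⟨k, hk, rfl⟩
      simp only [Finset.coe_range, Set.mem_Iio]
      by_contra hlt
      rcases Nat.lt_or_ge (cdist n i j) (cdist n i k) with h | h
      · exact hn (hS j k hk h)
      · exact hn (cdist_inj n i k j (by omega) ▸ hk)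
    have := Set.ncard_le_ncard hsub (Set.toFinite _)
    rw [hc, Set.ncard_coe_finset, Finset.card_range] at this
    omega

lemma model_st {V : Type} [Fintype V] (M : CAModel V) (v : V) : (M.arc v).s ≠ (M.arc v).t := by
  intro h
  have := @M.endpoints_distinct (v, true) (v, false) (by simpa using h)
  simp at this

lemma model_ss {V : Type} [Fintype V] (M : CAModel V) {u v : V} (huv : u ≠ v) :
    (M.arc u).s ≠ (M.arc v).s := by
  intro h
  have := @M.endpoints_distinct (u, true) (v, true) (by simpa using h)
  simp at this
  exact huv this

lemma exists_sorted {V : Type} [Fintype V] (p : V → ℝ) (hp : Function.Injective p) :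
    ∃ σ : Fin (Fintype.card V) ≃ V, StrictMono (p ∘ σ) := by
  letI : LinearOrder V := LinearOrder.lift' p hp
  let e := Fintype.orderIsoFinOfCardEq V rfl
  exact ⟨e.toEquiv, fun a b h => e.strictMono h⟩

lemma not_startIn_self (A : Arc) : ¬ StartIn A A := by
  intro h
  have := h.1
  rw [cd_self] at this
  exact lt_irrefl _ this

lemma forward {V : Type} [Fintype V] (G : SimpleGraph V) (h : IsNCAGraph G) :
    ∃ (D : GraphOrientation G) (σ : Fin (Fintype.card V) ≃ V), IsOutRoundEnum D σ := by
  obtain ⟨M, hN, hM⟩ := h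
  have hadj : ∀ u v, G.Adj u v ↔ u ≠ v ∧
      (StartIn (M.arc u) (M.arc v) ∨ StartIn (M.arc v) (M.arc u)) := by
    intro u v
    rw [hM]
    refine and_congr_right fun huv => ?_
    exact inter_iff_s17 _ _ (model_ss M huv) (model_st M u) (model_st M v)
  have hnot : ∀ u v, ¬ (StartIn (M.arc u) (M.arc v) ∧ StartIn (M.arc v) (M.arc u)) := by
    intro u v h
    by_cases huv : u = v
    · subst huv; exact not_startIn_self _ h.1
    · exact hN u v huv ((cover_iff _ _ (model_ss M huv)).2 h)
  let D : GraphOrientation G :=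
    { dir := fun u v => StartIn (M.arc u) (M.arc v)
      dir_adj := fun u v h => (hadj u v).2 ⟨by
        rintro rfl; exact not_startIn_self _ h, Or.inl h⟩
      adj_dir := fun u v h => by
        have h1 := ((hadj u v).1 h).2
        have h2 := hnot u v
        tauto }
  obtain ⟨σ, hσ⟩ := exists_sorted (fun v => cd 0 (M.arc v).s) (by
    intro u v huv
    by_contra hne
    have h1 : cd 0 (M.arc u).s = cd 0 (M.arc v).s := huv
    have h2 := cd_coe 0 (M.arc u).s
    rw [h1, cd_coe, sub_zero, sub_zero] at h2
    exact model_ss M hne h2.symm)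
  refine ⟨D, σ, ?_⟩
  intro i j
  have hcard : {k | σ k = σ i ∨ D.dir (σ i) (σ k)}.ncard = D.outDeg (σ i) + 1 := by
    have h1 : {k | σ k = σ i ∨ D.dir (σ i) (σ k)} = σ ⁻¹' (insert (σ i) {w | D.dir (σ i) w}) := by
      ext k; simp
    rw [h1, ← Equiv.image_symm_eq_preimage, Set.ncard_image_of_injective _ σ.symm.injective,
      Set.ncard_insert_of_notMem (show σ i ∉ {w | D.dir (σ i) w} from not_startIn_self _)]
    rfl
  refine initial_range _ i {k | σ k = σ i ∨ D.dir (σ i) (σ k)} _ hcard ?_ j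
  clear j
  intro j k hk hjk
  have hik : i ≠ k := by
    rintro rfl
    rw [cdist_self] at hjk
    omega
  by_cases hij : i = j
  · left; rw [hij]
  right
  have hk' : D.dir (σ i) (σ k) := by
    rcases hk with hk | hk
    · exact absurd (σ.injective hk).symm hik
    · exact hk
  have hk2 : cd (M.arc (σ i)).s (M.arc (σ k)).s < cd (M.arc (σ i)).s (M.arc (σ i)).t := hk'.2
  refine ⟨cd_pos (model_ss M (σ.injective.ne hij)), lt_of_le_of_lt ?_ hk2⟩
  have hm : ∀ a b : Fin (Fintype.card V), a < b →
    cd 0 (M.arc (σ a)).s < cd 0 (M.arc (σ b)).s := fun a b h => hσ h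
  have key : ∀ a : Fin (Fintype.card V), a ≠ i →
      (i < a ∧ cd 0 (M.arc (σ a)).s = cd 0 (M.arc (σ i)).s + cd (M.arc (σ i)).s (M.arc (σ a)).s) ∨
      (a < i ∧ cd 0 (M.arc (σ a)).s
        = cd 0 (M.arc (σ i)).s + cd (M.arc (σ i)).s (M.arc (σ a)).s - 1) := by
    intro a ha
    have h1 := cd_nonneg (M.arc (σ i)).s (M.arc (σ a)).s
    have h2 := cd_lt (M.arc (σ i)).s (M.arc (σ a)).s
    rcases lt_or_gt_of_ne ha with h | h
    · right; refine ⟨h, ?_⟩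
      have := hm _ _ h
      rcases cd_add 0 (M.arc (σ i)).s (M.arc (σ a)).s with h3 | h3 <;> linarith
    · left; refine ⟨h, ?_⟩
      have := hm _ _ h
      rcases cd_add 0 (M.arc (σ i)).s (M.arc (σ a)).s with h3 | h3 <;> linarith
  have hj0 := cd_lt 0 (M.arc (σ j)).s
  have hk0 := cd_nonneg 0 (M.arc (σ k)).s
  have hjn := j.2
  rcases key j (Ne.symm hij) with ⟨j1, j2⟩ | ⟨j1, j2⟩ <;>
  rcases key k (Ne.symm hik) with ⟨k1, k2⟩ | ⟨k1, k2⟩ <;>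
  rcases cdist_cases _ i j with ⟨j3, j4⟩ | ⟨j3, j4⟩ <;>
  rcases cdist_cases _ i k with ⟨k3, k4⟩ | ⟨k3, k4⟩ <;>
  first
  | (exfalso; simp only [Fin.le_def, Fin.lt_def] at j1 j3 k1 k3; omega)
  | (have := hm j k (by simp only [Fin.lt_def]; omega); linarith)
  | linarith

lemma backward {V : Type} [Fintype V] (G : SimpleGraph V) (D : GraphOrientation G)
    (n : ℕ) (hn : n = Fintype.card V) (σ : Fin n ≃ V)
    (h : ∀ i j : Fin n, (σ j = σ i ∨ D.dir (σ i) (σ j)) ↔ cdist n i j ≤ D.outDeg (σ i)) :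
    IsNCAGraph G := by
  -- out-degree bound
  have hdn : ∀ v, D.outDeg v < n := by
    intro v
    have h1 : {w | D.dir v w} ⊂ Set.univ := by
      rw [Set.ssubset_univ_iff]
      intro h
      have : v ∈ {w | D.dir v w} := h ▸ Set.mem_univ v
      exact G.loopless.irrefl v (D.dir_adj _ _ this)
    have h2 := Set.ncard_lt_ncard h1 (Set.toFinite _)
    rwa [Set.ncard_univ, Nat.card_eq_fintype_card, ← hn] at h2
  let S : V → Circ := fun v => (((σ.symm v : ℕ) / n : ℝ) : Circ)
  let e : V → ℝ := fun v => ((σ.symm v : ℕ) + 1 : ℝ) / (n + 1)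
  let L : V → ℝ := fun v => (D.outDeg v + e v) / n
  let A : V → Arc := fun v => ⟨S v, S v + (L v : Circ)⟩
  have npos : V → (0:ℝ) < n := fun v => by
    have := (σ.symm v).2
    exact_mod_cast (by omega : 0 < n)
  have he : ∀ v, 0 < e v ∧ e v < 1 := by
    intro v
    have h1 : ((σ.symm v : ℕ) : ℝ) < n := by exact_mod_cast (σ.symm v).2
    have h0 := npos v
    constructor
    · positivity
    · show ((σ.symm v : ℕ) + 1 : ℝ) / (n + 1) < 1
      rw [div_lt_one (by linarith)]; linarith
  have hL : ∀ v, 0 < L v ∧ L v < 1 := by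
    intro v
    have h0 := npos v
    have h1 := he v
    have h2 : (D.outDeg v : ℝ) + 1 ≤ n := by exact_mod_cast hdn v
    constructor
    · have := h1.1
      positivity
    · show (D.outDeg v + e v) / n < 1
      rw [div_lt_one h0]; linarith
  have hcdS : ∀ u v, cd (S u) (S v) = (cdist n (σ.symm u) (σ.symm v) : ℝ) / n := by
    intro u v
    have h0 := npos v
    apply cd_unique
    · positivity
    · rw [div_lt_one h0]; exact_mod_cast cdist_lt _ _ _
    · show _ = (((σ.symm v : ℕ) / n : ℝ) : Circ) - (((σ.symm u : ℕ) / n : ℝ) : Circ)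
      rw [← AddCircle.coe_sub]
      rcases cdist_cases n (σ.symm u) (σ.symm v) with ⟨_, h1⟩ | ⟨_, h1⟩
      · have h2 : (cdist n (σ.symm u) (σ.symm v) : ℝ) + (σ.symm u : ℕ) = (σ.symm v : ℕ) := by
          exact_mod_cast h1
        congr 1
        rw [← h2]; ring
      · have h2 : (cdist n (σ.symm u) (σ.symm v) : ℝ) + (σ.symm u : ℕ) = (σ.symm v : ℕ) + n := by
          exact_mod_cast h1
        rw [← coe_sub_one]
        congr 1
        field_simp
        linarith
  have hcdT : ∀ v, cd (A v).s (A v).t = L v := fun v => cd_shift _ _ (hL v).1.le (hL v).2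
  have hSne : ∀ u v, u ≠ v → S u ≠ S v := by
    intro u v huv hS
    have h1 := hcdS u v
    rw [hS, cd_self] at h1
    have h0 := npos v
    have h2 : (cdist n (σ.symm u) (σ.symm v) : ℝ) = 0 := by
      field_simp at h1; linarith
    have h3 : cdist n (σ.symm u) (σ.symm v) = 0 := by exact_mod_cast h2
    have := cdist_inj n (σ.symm u) (σ.symm v) (σ.symm u) (by rw [h3, cdist_self])
    exact huv (σ.symm.injective this).symm
  have hstart : ∀ u v, StartIn (A u) (A v) ↔ D.dir u v := by
    intro u v
    have h0 := npos v
    by_cases huv : u = v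
    · subst huv
      exact ⟨fun h => absurd h (not_startIn_self _),
        fun h => absurd (D.dir_adj _ _ h) (G.loopless.irrefl u)⟩
    have h1 := h (σ.symm u) (σ.symm v)
    change (σ (σ.symm v) = σ (σ.symm u) ∨ D.dir (σ (σ.symm u)) (σ (σ.symm v))) ↔
      cdist n (σ.symm u) (σ.symm v) ≤ D.outDeg (σ (σ.symm u)) at h1
    rw [σ.apply_symm_apply, σ.apply_symm_apply] at h1
    have h2 : D.dir u v ↔ cdist n (σ.symm u) (σ.symm v) ≤ D.outDeg u := by
      rw [← h1]
      exact ⟨Or.inr, fun h => h.resolve_left (Ne.symm huv)⟩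
    rw [h2]
    have hpos : 0 < cd (A u).s (A v).s := cd_pos (hSne u v huv)
    have hcd : cd (A u).s (A v).s = (cdist n (σ.symm u) (σ.symm v) : ℝ) / n := hcdS u v
    have h3 : StartIn (A u) (A v) ↔
        (cdist n (σ.symm u) (σ.symm v) : ℝ) < D.outDeg u + e u := by
      unfold StartIn
      rw [hcdT, and_iff_right hpos, hcd]
      exact div_lt_div_iff_of_pos_right h0
    rw [h3]
    have he' := he u
    constructor
    · intro h4
      have : (cdist n (σ.symm u) (σ.symm v) : ℝ) < (D.outDeg u + 1 : ℕ) := by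
        push_cast; linarith
      have := Nat.cast_lt.mp this
      omega
    · intro h4
      have : (cdist n (σ.symm u) (σ.symm v) : ℝ) ≤ D.outDeg u := by exact_mod_cast h4
      linarith
  have hST : ∀ u v, (A u).s ≠ (A v).t := by
    intro u v huv
    have h0 := npos v
    have h1 := hcdT v
    rw [← huv] at h1
    have h2 : (cdist n (σ.symm v) (σ.symm u) : ℝ) / n = (D.outDeg v + e v) / n :=
      (hcdS v u).symm.trans h1
    rw [div_left_inj' h0.ne'] at h2
    have he' := he v
    have h3 : (D.outDeg v : ℝ) < cdist n (σ.symm v) (σ.symm u) := by linarith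
    have h4 : (cdist n (σ.symm v) (σ.symm u) : ℝ) < (D.outDeg v + 1 : ℕ) := by
      push_cast; linarith
    have h3' := Nat.cast_lt.mp h3
    have h4' := Nat.cast_lt.mp h4
    omega
  have hTT : ∀ u v, (A u).t = (A v).t → u = v := by
    intro u v huv
    have h0 := npos v
    have h1 := hcdT u
    have h2 := hcdT v
    rw [huv] at h1
    have h3 : cd (A u).s (A v).s = (cdist n (σ.symm u) (σ.symm v) : ℝ) / n := hcdS u v
    have hz : ∃ z : ℤ, e u - e v = z := by
      rcases cd_add (A u).s (A v).s (A v).t with h4 | h4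
      · rw [h1, h2, h3] at h4
        have h5 : (D.outDeg u + e u) / n
          = (cdist n (σ.symm u) (σ.symm v) : ℝ) / n + (D.outDeg v + e v) / n := h4
        refine ⟨cdist n (σ.symm u) (σ.symm v) + D.outDeg v - D.outDeg u, ?_⟩
        field_simp at h5
        push_cast
        linarith
      · rw [h1, h2, h3] at h4
        have h5 : (D.outDeg u + e u) / n
          = (cdist n (σ.symm u) (σ.symm v) : ℝ) / n + (D.outDeg v + e v) / n - 1 := h4
        refine ⟨cdist n (σ.symm u) (σ.symm v) + D.outDeg v - D.outDeg u - n, ?_⟩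
        field_simp at h5
        push_cast
        linarith
    obtain ⟨z, hz⟩ := hz
    have hu := he u
    have hv := he v
    have z1 : (z : ℝ) < 1 := by linarith
    have z2 : (-1 : ℝ) < z := by linarith
    have z1' : z < 1 := by exact_mod_cast z1
    have z2' : -1 < z := by exact_mod_cast z2
    have z0 : z = 0 := by omega
    rw [z0, Int.cast_zero] at hz
    have h6 : ((σ.symm u : ℕ) + 1 : ℝ) / (n + 1) = ((σ.symm v : ℕ) + 1 : ℝ) / (n + 1) :=
      sub_eq_zero.mp hz
    rw [div_left_inj' (by positivity)] at h6
    have h7 : ((σ.symm u : ℕ) : ℝ) = (σ.symm v : ℕ) := by linarith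
    exact σ.symm.injective (Fin.ext (by exact_mod_cast h7))
  have hss : ∀ u v, (A u).s = (A v).s → u = v := by
    intro u v huv
    by_contra hne
    exact hSne u v hne huv
  let M : CAModel V :=
    { arc := A
      endpoints_distinct := by
        rintro ⟨u, a⟩ ⟨v, b⟩ hab
        cases a <;> cases b <;> simp only [if_true, if_false, Bool.false_eq_true] at hab
        · rw [hTT u v hab]
        · exact absurd hab.symm (hST v u)
        · exact absurd hab (hST u v)
        · rw [hss u v hab] }
  refine ⟨M, ?_, ?_⟩
  · intro u v huv hc
    have h1 := (cover_iff (A u) (A v) (hSne u v huv)).1 hc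
    rw [hstart, hstart] at h1
    exact (D.adj_dir u v (D.dir_adj _ _ h1.1)).1 h1.1 h1.2
  · intro u v
    have key : ∀ huv : u ≠ v, M.Inter u v ↔ (D.dir u v ∨ D.dir v u) := by
      intro huv
      have := inter_iff_s17 (A u) (A v) (hSne u v huv) (hST u u) (hST v v)
      rw [hstart, hstart] at this
      exact this
    constructor
    · intro hadj
      refine ⟨hadj.ne, (key hadj.ne).2 ?_⟩
      have := D.adj_dir u v hadj
      tauto
    · rintro ⟨huv, hi⟩
      rcases (key huv).1 hi with h1 | h1
      · exact D.dir_adj _ _ h1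
      · exact (D.dir_adj _ _ h1).symm

/-- A graph is an NCA graph iff it admits an out-round orientation. -/
theorem stmt_17 {V : Type} [Fintype V] (G : SimpleGraph V) :
    IsNCAGraph G ↔
      ∃ (D : GraphOrientation G) (σ : Fin (Fintype.card V) ≃ V), IsOutRoundEnum D σ := by
  exact ⟨forward G, fun ⟨D, σ, h⟩ => backward G D _ rfl σ h⟩
end
end
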